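/- arXiv:0903.1881 — 2 statements merged into one kernel-verified Lean document; each statement's English description precedes it below -/
import Mathlib

section
/- Let X be an infinite compact space with a minimal free action φ of ℤ^d by homeomorphisms, and let v be a unitary in C(X)⋊_φℤ^d with v C(X) v* = C(X). Then there exist pairwise orthogonal projections (p_g)_{g∈ℤ^d} in C(X), only finitely many nonzero, with Σ_g p_g = 1, and a unitary f ∈ C(X) such that v = f Σ_{g∈ℤ^d} p_g U_φ^g. -/
/-- A covariant pair for the system `(Z, ψ, ℤ^d)` in a normed star algebra `A`. -/
def IsCovariantPair {d : ℕ} {Z : Type*} [TopologicalSpace Z] [CompactSpace Z]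
    (ψ : (Fin d → ℤ) → Z ≃ₜ Z) {A : Type*} [NormedRing A] [StarRing A]
    [NormedAlgebra ℂ A] [StarModule ℂ A]
    (ι : C(Z, ℂ) →⋆ₐ[ℂ] A) (U : (Fin d → ℤ) → A) : Prop :=
  (∀ z, U z ∈ unitary A) ∧ U 0 = 1 ∧ (∀ z w, U (z + w) = U z * U w) ∧
    ∀ (z : Fin d → ℤ) (f : C(Z, ℂ)),
      U z * ι f * star (U z) = ι (f.comp ⟨⇑(ψ (-z)), (ψ (-z)).continuous⟩)

/-- The universal property characterizing the crossed product `C(Z) ⋊_ψ ℤ^d`. -/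
def IsUniversalCrossedProduct {d : ℕ} {Z : Type*} [TopologicalSpace Z] [CompactSpace Z]
    (ψ : (Fin d → ℤ) → Z ≃ₜ Z) {A : Type*} [NormedRing A] [StarRing A]
    [NormedAlgebra ℂ A] [StarModule ℂ A]
    (ι : C(Z, ℂ) →⋆ₐ[ℂ] A) (U : (Fin d → ℤ) → A) : Prop :=
  IsCovariantPair ψ ι U ∧
    closure ((StarAlgebra.adjoin ℂ (Set.range ⇑ι ∪ Set.range U) : StarSubalgebra ℂ A) :
      Set A) = Set.univ ∧
    ∀ (B : Type*) [NormedRing B] [StarRing B] [NormedAlgebra ℂ B] [StarModule ℂ B]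
      [CStarRing B] [CompleteSpace B] (π : C(Z, ℂ) →⋆ₐ[ℂ] B) (u : (Fin d → ℤ) → B),
      IsCovariantPair ψ π u →
        ∃! Φ : A →⋆ₐ[ℂ] B, (∀ f, Φ (ι f) = π f) ∧ ∀ z, Φ (U z) = u z

set_option linter.unusedSectionVars false

open scoped ComplexStarModule in
/-- The map `b ↦ ∑ h_i b h_i` with `∑ h_i² = 1`, `h_i` selfadjoint, is bounded. -/
theorem aux_contr_sa {A : Type*} [CStarAlgebra A] {I : Type*} (s : Finset I) (h : I → A)
    (hs : ∀ i, star (h i) = h i) (h1 : ∑ i ∈ s, h i * h i = 1) (b : A) (hb : IsSelfAdjoint b) :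
    ‖∑ i ∈ s, h i * b * h i‖ ≤ 3 * ‖b‖ := by
  let := CStarAlgebra.spectralOrder A
  let := CStarAlgebra.spectralOrderedRing A
  nontriviality A
  set r : A := algebraMap ℝ A ‖b‖ with hr
  have hrn : ‖r‖ = ‖b‖ := by simp [hr]
  have hLr : ∀ t : ℝ, ∑ i ∈ s, h i * algebraMap ℝ A t * h i = algebraMap ℝ A t := by
    intro t
    have : ∀ i, h i * algebraMap ℝ A t * h i = algebraMap ℝ A t * (h i * h i) := by
      intro i
      rw [← Algebra.commutes, mul_assoc]
    simp_rw [this]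
    rw [← Finset.mul_sum, h1, mul_one]
  have hmono : ∀ a c : A, a ≤ c → ∑ i ∈ s, h i * a * h i ≤ ∑ i ∈ s, h i * c * h i := by
    intro a c hac
    refine Finset.sum_le_sum fun i _ => ?_
    have := star_left_conjugate_le_conjugate hac (h i)
    rwa [hs i] at this
  have hadd : ∑ i ∈ s, h i * (b + r) * h i = ∑ i ∈ s, h i * b * h i + r := by
    simp_rw [mul_add, add_mul, Finset.sum_add_distrib]
    rw [hLr]
  have e1 : b ≤ r := hb.le_algebraMap_norm_self
  have e2 : -r ≤ b := hb.neg_algebraMap_norm_le_self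
  have e3 : 0 ≤ b + r := by simpa using add_le_add_left e2 r
  have f1 : 0 ≤ ∑ i ∈ s, h i * b * h i + r := by
    rw [← hadd]; simpa using hmono _ _ e3
  have f2 : ∑ i ∈ s, h i * b * h i + r ≤ r + r := by
    have := hmono _ _ e1
    rw [hLr] at this
    exact add_le_add_left this r
  have f3 := CStarAlgebra.norm_le_norm_of_nonneg_of_le f1 f2
  have f4 : ‖r + r‖ ≤ ‖b‖ + ‖b‖ := (norm_add_le _ _).trans (by rw [hrn])
  have f5 := norm_sub_le (∑ i ∈ s, h i * b * h i + r) r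
  rw [add_sub_cancel_right, hrn] at f5
  linarith

open scoped ComplexStarModule in
theorem aux_contr {A : Type*} [CStarAlgebra A] {I : Type*} (s : Finset I) (h : I → A)
    (hs : ∀ i, star (h i) = h i) (h1 : ∑ i ∈ s, h i * h i = 1) (b : A) :
    ‖∑ i ∈ s, h i * b * h i‖ ≤ 6 * ‖b‖ := by
  have k1 := aux_contr_sa s h hs h1 (ℜ b : A) (ℜ b).2
  have k2 := aux_contr_sa s h hs h1 (ℑ b : A) (ℑ b).2
  have k3 : ‖(ℜ b : A)‖ ≤ ‖b‖ := realPart.norm_le b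
  have k4 : ‖(ℑ b : A)‖ ≤ ‖b‖ := imaginaryPart.norm_le b
  have k5 : ∑ i ∈ s, h i * b * h i = ∑ i ∈ s, h i * (ℜ b : A) * h i
      + Complex.I • ∑ i ∈ s, h i * (ℑ b : A) * h i := by
    conv_lhs => rw [← realPart_add_I_smul_imaginaryPart b]
    simp only [mul_add, add_mul, Finset.sum_add_distrib, Finset.smul_sum, mul_smul_comm,
      smul_mul_assoc]
  rw [k5]
  refine (norm_add_le _ _).trans ?_
  rw [norm_smul]
  simp only [Complex.norm_I, one_mul]
  linarith

/-- Urysohn, complex valued. -/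
theorem aux_bump {X : Type*} [TopologicalSpace X] [CompactSpace X] [T2Space X]
    (O : Set X) (hO : IsOpen O) (x : X) (hx : x ∈ O) :
    ∃ h : C(X, ℂ), h x = 1 ∧ (∀ y, y ∉ O → h y = 0) ∧ ‖h‖ ≤ 1 := by
  obtain ⟨f, f0, f1, f2⟩ := exists_continuous_zero_one_of_isClosed hO.isClosed_compl
    (isClosed_singleton (x := x)) (by simpa using hx)
  refine ⟨⟨fun y => (f y : ℂ), by fun_prop⟩, ?_, ?_, ?_⟩
  · have := f1 (Set.mem_singleton x)
    simp at this
    simp [this]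
  · intro y hy
    have := f0 (show y ∈ Oᶜ from hy)
    simp at this
    simp [this]
  · rw [ContinuousMap.norm_le _ zero_le_one]
    intro y
    simp only [ContinuousMap.coe_mk, Complex.norm_real, Real.norm_eq_abs]
    rw [abs_of_nonneg (f2 y).1]
    exact (f2 y).2

section aux
variable {d : ℕ} {X : Type*} [TopologicalSpace X] [CompactSpace X]
    {φ : (Fin d → ℤ) → X ≃ₜ X}
    {A : Type*} [NormedRing A] [StarRing A] [NormedAlgebra ℂ A]
    [StarModule ℂ A] {ι : C(X, ℂ) →⋆ₐ[ℂ] A} {U : (Fin d → ℤ) → A}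

/-- translation of functions -/
noncomputable def auxT (φ : (Fin d → ℤ) → X ≃ₜ X) (z : Fin d → ℤ) (f : C(X, ℂ)) : C(X, ℂ) :=
  f.comp ⟨⇑(φ (-z)), (φ (-z)).continuous⟩

theorem auxT_apply (z : Fin d → ℤ) (f : C(X, ℂ)) (x : X) :
    auxT φ z f x = f (φ (-z) x) := rfl

theorem aux_comm (h : IsCovariantPair φ ι U) (z : Fin d → ℤ) (f : C(X, ℂ)) :
    U z * ι f = ι (auxT φ z f) * U z := by
  obtain ⟨hu, h0, hm, hc⟩ := h
  rw [auxT, ← hc z f, mul_assoc, mul_assoc, (Unitary.mem_iff.1 (hu z)).1, mul_one]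

theorem aux_star (h : IsCovariantPair φ ι U) (z : Fin d → ℤ) : star (U z) = U (-z) := by
  obtain ⟨hu, h0, hm, hc⟩ := h
  have h1 : U z * U (-z) = 1 := by rw [← hm, add_neg_cancel, h0]
  calc star (U z) = star (U z) * (U z * U (-z)) := by rw [h1, mul_one]
    _ = U (-z) := by rw [← mul_assoc, (Unitary.mem_iff.1 (hu z)).1, one_mul]

/-- the finite sums `∑ f_g U_g` -/
noncomputable def auxS (ι : C(X, ℂ) →⋆ₐ[ℂ] A) (U : (Fin d → ℤ) → A)
    (c : (Fin d → ℤ) →₀ C(X, ℂ)) : A :=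
  c.sum fun g f => ι f * U g

theorem auxS_add (c e : (Fin d → ℤ) →₀ C(X, ℂ)) :
    auxS ι U (c + e) = auxS ι U c + auxS ι U e := by
  unfold auxS
  exact Finsupp.sum_add_index' (by simp) (by intros; rw [map_add, add_mul])

theorem auxS_single (g : Fin d → ℤ) (f : C(X, ℂ)) :
    auxS ι U (Finsupp.single g f) = ι f * U g := by
  unfold auxS
  exact Finsupp.sum_single_index (by simp)

theorem auxS_zero : auxS ι U 0 = 0 := by
  simp [auxS]

theorem auxS_mul (h : IsCovariantPair φ ι U) (c e : (Fin d → ℤ) →₀ C(X, ℂ)) :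
    ∃ k, auxS ι U c * auxS ι U e = auxS ι U k := by
  induction c using Finsupp.induction_linear with
  | zero => exact ⟨0, by simp [auxS_zero]⟩
  | add c₁ c₂ h₁ h₂ =>
    obtain ⟨k₁, h₁⟩ := h₁
    obtain ⟨k₂, h₂⟩ := h₂
    exact ⟨k₁ + k₂, by rw [auxS_add, auxS_add, add_mul, h₁, h₂]⟩
  | single g f =>
    induction e using Finsupp.induction_linear with
    | zero => exact ⟨0, by simp [auxS_zero]⟩
    | add c₁ c₂ h₁ h₂ =>
      obtain ⟨k₁, h₁⟩ := h₁
      obtain ⟨k₂, h₂⟩ := h₂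
      exact ⟨k₁ + k₂, by rw [auxS_add, auxS_add, mul_add, h₁, h₂]⟩
    | single g' f' =>
      refine ⟨Finsupp.single (g + g') (f * auxT φ g f'), ?_⟩
      rw [auxS_single, auxS_single, auxS_single, h.2.2.1, map_mul]
      calc ι f * U g * (ι f' * U g') = ι f * (U g * ι f') * U g' := by simp only [mul_assoc]
        _ = _ := by rw [aux_comm h]; simp only [mul_assoc]

theorem auxS_star (h : IsCovariantPair φ ι U) (c : (Fin d → ℤ) →₀ C(X, ℂ)) :
    ∃ k, star (auxS ι U c) = auxS ι U k := by
  induction c using Finsupp.induction_linear with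
  | zero => exact ⟨0, by simp [auxS_zero]⟩
  | add c₁ c₂ h₁ h₂ =>
    obtain ⟨k₁, h₁⟩ := h₁
    obtain ⟨k₂, h₂⟩ := h₂
    exact ⟨k₁ + k₂, by rw [auxS_add, auxS_add, star_add, h₁, h₂]⟩
  | single g f =>
    refine ⟨Finsupp.single (-g) (auxT φ (-g) (star f)), ?_⟩
    rw [auxS_single, auxS_single, star_mul, aux_star h, ← map_star, aux_comm h]

theorem auxS_adjoin (h : IsCovariantPair φ ι U) (a : A)
    (ha : a ∈ StarAlgebra.adjoin ℂ (Set.range ⇑ι ∪ Set.range U)) : ∃ k, a = auxS ι U k := by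
  induction ha using StarAlgebra.adjoin_induction with
  | mem x hx =>
    rcases hx with ⟨f, rfl⟩ | ⟨g, rfl⟩
    · exact ⟨Finsupp.single 0 f, by rw [auxS_single, h.2.1, mul_one]⟩
    · exact ⟨Finsupp.single g 1, by rw [auxS_single, map_one, one_mul]⟩
  | algebraMap r =>
    exact ⟨Finsupp.single 0 (algebraMap ℂ _ r), by
      rw [auxS_single, h.2.1, mul_one]; exact (AlgHomClass.commutes ι r).symm⟩
  | add x y _ _ hx hy =>
    obtain ⟨k₁, rfl⟩ := hx
    obtain ⟨k₂, rfl⟩ := hy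
    exact ⟨k₁ + k₂, (auxS_add _ _).symm⟩
  | mul x y _ _ hx hy =>
    obtain ⟨k₁, rfl⟩ := hx
    obtain ⟨k₂, rfl⟩ := hy
    exact auxS_mul h _ _
  | star x _ hx =>
    obtain ⟨k₁, rfl⟩ := hx
    exact auxS_star h _

theorem aux_approx (hA : IsUniversalCrossedProduct φ ι U) (a : A) (ε : ℝ) (hε : 0 < ε) :
    ∃ k, ‖a - auxS ι U k‖ < ε := by
  have : a ∈ closure ((StarAlgebra.adjoin ℂ (Set.range ⇑ι ∪ Set.range U) : StarSubalgebra ℂ A) :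
      Set A) := by rw [hA.2.1]; trivial
  obtain ⟨b, hb, hab⟩ := Metric.mem_closure_iff.1 this ε hε
  obtain ⟨k, rfl⟩ := auxS_adjoin hA.1 b hb
  exact ⟨k, by rwa [dist_eq_norm] at hab⟩

theorem auxS_sandwich (h : IsCovariantPair φ ι U) (c : (Fin d → ℤ) →₀ C(X, ℂ))
    (p q : C(X, ℂ)) :
    ι p * auxS ι U c * ι q = c.sum fun g f => ι (p * f * auxT φ g q) * U g := by
  unfold auxS Finsupp.sum
  rw [Finset.mul_sum, Finset.sum_mul]
  refine Finset.sum_congr rfl fun g _ => ?_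
  beta_reduce
  rw [map_mul, map_mul]
  simp only [mul_assoc]
  rw [aux_comm h]

theorem aux_zero (hφadd : ∀ v w x, φ (v + w) x = φ v (φ w x)) (x : X) : φ 0 x = x := by
  have := hφadd 0 0 x
  rw [add_zero] at this
  exact ((φ 0).injective this).symm

end aux

/-- A partition of unity by squares, subordinate to the freeness of the action. -/
theorem aux_partition {d : ℕ} {X : Type*} [TopologicalSpace X] [CompactSpace X] [T2Space X]
    (φ : (Fin d → ℤ) → X ≃ₜ X)
    (hφfree : ∀ (v) (x : X), φ v x = x → v = 0) (F : Finset (Fin d → ℤ)) :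
    ∃ (s : Finset X) (h : X → C(X, ℂ)), (∀ i, star (h i) = h i) ∧
      (∑ i ∈ s, h i * h i = 1) ∧
      ∀ i ∈ s, ∀ g ∈ F, g ≠ 0 → ∀ x, h i x * h i (φ (-g) x) = 0 := by
  classical
  have hV : ∀ x : X, ∃ V : Set X, IsOpen V ∧ x ∈ V ∧
      ∀ g ∈ F, g ≠ 0 → ∀ y ∈ V, φ (-g) y ∉ V := by
    intro x
    have : ∀ g : Fin d → ℤ, ∃ V : Set X, IsOpen V ∧ x ∈ V ∧ (g ≠ 0 → ∀ y ∈ V, φ (-g) y ∉ V) := by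
      intro g
      by_cases hg : g = 0
      · exact ⟨Set.univ, isOpen_univ, trivial, fun h => absurd hg h⟩
      have hne : x ≠ φ (-g) x := fun h => hg (neg_eq_zero.1 (hφfree _ _ h.symm))
      obtain ⟨P, Q, hP, hQ, hxP, hxQ, hPQ⟩ := t2_separation hne
      refine ⟨P ∩ φ (-g) ⁻¹' Q, hP.inter (hQ.preimage (φ (-g)).continuous), ⟨hxP, hxQ⟩, ?_⟩
      intro _ y hy hy'
      exact Set.disjoint_left.1 hPQ hy'.1 hy.2
    choose V hVo hVx hVg using this
    refine ⟨⋂ g ∈ F, V g, isOpen_biInter_finset fun g _ => hVo g, ?_, ?_⟩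
    · simp only [Set.mem_iInter]
      exact fun g _ => hVx g
    · intro g hg hg0 y hy hy'
      simp only [Set.mem_iInter] at hy hy'
      exact hVg g hg0 y (hy g hg) (hy' g hg)
  choose V hVo hVx hVg using hV
  obtain ⟨ρ, hρ⟩ := PartitionOfUnity.exists_isSubordinate (s := (Set.univ : Set X)) isClosed_univ V
    hVo (fun x _ => Set.mem_iUnion.2 ⟨x, hVx x⟩)
  have hfin : {i | (Function.support (ρ i)).Nonempty}.Finite :=
    ρ.locallyFinite.finite_nonempty_of_compact
  refine ⟨hfin.toFinset, fun i => ⟨fun x => ((Real.sqrt (ρ i x) : ℝ) : ℂ), by fun_prop⟩, ?_, ?_, ?_⟩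
  · intro i
    ext x
    simp
  · ext x
    have h1 := ρ.sum_eq_one (Set.mem_univ x)
    rw [finsum_eq_sum_of_support_subset (s := hfin.toFinset)] at h1
    · simp only [ContinuousMap.coe_sum, Finset.sum_apply, ContinuousMap.mul_apply,
        ContinuousMap.coe_mk, ContinuousMap.one_apply]
      rw [← Complex.ofReal_one, ← h1, Complex.ofReal_sum]
      refine Finset.sum_congr rfl fun i _ => ?_
      rw [← Complex.ofReal_mul, Real.mul_self_sqrt (ρ.nonneg i x)]
    · intro i hi
      simp only [Set.Finite.coe_toFinset, Set.mem_ofPred_eq]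
      exact ⟨x, hi⟩
  · intro i _ g hg hg0 x
    have hz : ∀ y, y ∉ V i → ρ i y = 0 := by
      intro y hy
      by_contra hne
      exact hy (hρ i (subset_closure hne))
    simp only [ContinuousMap.coe_mk]
    by_cases hx : x ∈ V i
    · rw [hz _ (hVg i g hg hg0 x hx)]; simp
    · rw [hz _ hx]; simp

/-- `C(X)` is maximal abelian. -/
theorem aux_masa {d : ℕ} {X : Type*} [TopologicalSpace X] [CompactSpace X] [T2Space X]
    (φ : (Fin d → ℤ) → X ≃ₜ X)
    (hφadd : ∀ v w x, φ (v + w) x = φ v (φ w x))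
    (hφfree : ∀ (v) (x : X), φ v x = x → v = 0)
    {A : Type*} [NormedRing A] [StarRing A] [CStarRing A] [NormedAlgebra ℂ A]
    [StarModule ℂ A] [CompleteSpace A]
    (ι : C(X, ℂ) →⋆ₐ[ℂ] A) (U : (Fin d → ℤ) → A)
    (hA : IsUniversalCrossedProduct φ ι U) (hι : Isometry ι)
    (c : A) (hc : ∀ f, c * ι f = ι f * c) : ∃ k, c = ι k := by
  let : CStarAlgebra A := {}
  have hcl : IsClosed (Set.range ι) := hι.isClosedEmbedding.isClosed_range
  suffices c ∈ Set.range ι by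
    obtain ⟨k, hk⟩ := this
    exact ⟨k, hk.symm⟩
  rw [← hcl.closure_eq, Metric.mem_closure_iff]
  intro ε hε
  obtain ⟨w, hw⟩ := aux_approx hA c (ε / 6) (by positivity)
  obtain ⟨s, h, hs, h1, h0⟩ := aux_partition φ hφfree w.support
  refine ⟨ι (w 0), ⟨_, rfl⟩, ?_⟩
  have h1' : ∑ i ∈ s, ι (h i) * ι (h i) = 1 := by
    simp_rw [← map_mul]
    rw [← map_sum, h1, map_one]
  have k1 := aux_contr s (fun i => ι (h i)) (fun i => by rw [← map_star, hs]) h1'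
    (c - auxS ι U w)
  have k2 : ∑ i ∈ s, ι (h i) * c * ι (h i) = c := by
    simp_rw [mul_assoc, hc, ← mul_assoc]
    rw [← Finset.sum_mul, h1', one_mul]
  have k3 : ∀ i ∈ s, ι (h i) * auxS ι U w * ι (h i) = ι (w 0) * (ι (h i) * ι (h i)) := by
    intro i hi
    rw [auxS_sandwich hA.1, Finsupp.sum, Finset.sum_eq_single 0]
    · rw [hA.1.2.1, mul_one, ← map_mul, ← map_mul]
      congr 1
      ext x
      simp only [ContinuousMap.mul_apply, auxT_apply, neg_zero, aux_zero hφadd]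
      ring
    · intro g hg hg0
      have : h i * w g * auxT φ g (h i) = 0 := by
        ext x
        simp only [ContinuousMap.mul_apply, auxT_apply, ContinuousMap.zero_apply]
        have := h0 i hi g hg hg0 x
        linear_combination (w g x) * this
      rw [this, map_zero, zero_mul]
    · intro h0
      rw [Finsupp.notMem_support_iff.1 h0]
      simp
  have k4 : ∑ i ∈ s, ι (h i) * (c - auxS ι U w) * ι (h i) = c - ι (w 0) := by
    simp_rw [mul_sub, sub_mul, Finset.sum_sub_distrib]
    rw [k2, Finset.sum_congr rfl k3, ← Finset.mul_sum, h1', mul_one]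
  rw [k4] at k1
  rw [dist_eq_norm]
  linarith

/-- Every normalizer acts pointwise by the action. -/
theorem aux_pointwise {d : ℕ} {X : Type*} [TopologicalSpace X] [CompactSpace X] [T2Space X]
    (φ : (Fin d → ℤ) → X ≃ₜ X)
    {A : Type*} [NormedRing A] [StarRing A] [CStarRing A] [NormedAlgebra ℂ A]
    [StarModule ℂ A] [CompleteSpace A]
    (ι : C(X, ℂ) →⋆ₐ[ℂ] A) (U : (Fin d → ℤ) → A)
    (hA : IsUniversalCrossedProduct φ ι U) (hι : Isometry ι)
    (v : A) (hv : v ∈ unitary A)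
    (α : C(X, ℂ) →ₐ[ℂ] C(X, ℂ)) (hα : ∀ f, v * ι f = ι (α f) * v) :
    ∃ F : Finset (Fin d → ℤ), ∀ x, ∃ g ∈ F, ∀ f, α f x = f (φ (-g) x) := by
  classical
  have hn : ∀ f, ‖ι f‖ = ‖f‖ := fun f => by
    have := hι.dist_eq f 0
    simpa [dist_eq_norm] using this
  obtain ⟨w, hw⟩ := aux_approx hA v 1 one_pos
  refine ⟨w.support, fun x => ?_⟩
  -- the point `y`
  obtain ⟨y, hy⟩ : ∃ y : X, ∀ f, α f x = f y := by
    let χ : C(X, ℂ) →ₐ[ℂ] ℂ := (ContinuousMap.evalAlgHom ℂ ℂ x).comp α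
    obtain ⟨y, hy⟩ := (WeakDual.CharacterSpace.continuousMapEval_bijective X ℂ).2
      (WeakDual.CharacterSpace.equivAlgHom.symm χ)
    refine ⟨y, fun f => ?_⟩
    have := DFunLike.congr_fun hy f
    simp only [WeakDual.CharacterSpace.continuousMapEval_apply_apply] at this
    rw [this]
    rfl
  by_contra! hcon
  have hne : ∀ g ∈ w.support, y ≠ φ (-g) x := by
    rintro g hg rfl
    obtain ⟨f, hf⟩ := hcon g hg
    exact hf (hy f)
  have hdis : Disjoint ({y} : Set X) (w.support.image fun g => φ (-g) x : Finset X) := by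
    rw [Set.disjoint_singleton_left]
    intro hmem
    simp only [Finset.coe_image, Set.mem_image] at hmem
    obtain ⟨g, hg, h⟩ := hmem
    exact hne g hg h.symm
  obtain ⟨V, W, hV, hW, hyV, hZW, hVW⟩ := SeparatedNhds.of_isCompact_isCompact
    isCompact_singleton (Finset.finite_toSet _).isCompact hdis
  obtain ⟨k, k1, k0, kn⟩ := aux_bump V hV y (hyV rfl)
  obtain ⟨h, h1, h0, hhn⟩ := aux_bump (⋂ g ∈ w.support, φ (-g) ⁻¹' W)
    (isOpen_biInter_finset fun g _ => hW.preimage (φ (-g)).continuous) x (by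
      simp only [Set.mem_iInter]
      intro g hg
      exact hZW (by simpa using ⟨g, by simpa using hg, rfl⟩))
  have e1 : ι h * auxS ι U w * ι k = 0 := by
    rw [auxS_sandwich hA.1]
    refine Finset.sum_eq_zero fun g hg => ?_
    have : h * w g * auxT φ g k = 0 := by
      ext z
      simp only [ContinuousMap.mul_apply, auxT_apply, ContinuousMap.zero_apply]
      by_cases hz : z ∈ ⋂ g ∈ w.support, φ (-g) ⁻¹' W
      · simp only [Set.mem_iInter] at hz
        rw [k0 _ (fun hh => Set.disjoint_left.1 hVW hh (hz g hg)), mul_zero]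
      · rw [h0 _ hz]; ring
    beta_reduce
    rw [this, map_zero, zero_mul]
  have e2 : ι h * (v - auxS ι U w) * ι k = ι (h * α k) * v := by
    rw [mul_sub, sub_mul, e1, sub_zero, mul_assoc, hα, map_mul, mul_assoc]
  have e3 : 1 ≤ ‖ι h * (v - auxS ι U w) * ι k‖ := by
    rw [e2, CStarRing.norm_mul_mem_unitary _ hv, hn]
    have := (h * α k).norm_coe_le_norm x
    rw [ContinuousMap.mul_apply, h1, hy, k1] at this
    simpa using this
  have e4 : ‖ι h * (v - auxS ι U w) * ι k‖ ≤ 1 * ‖v - auxS ι U w‖ * 1 := by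
    refine (norm_mul_le _ _).trans ?_
    gcongr
    · refine (norm_mul_le _ _).trans ?_
      gcongr
      rw [hn]; exact hhn
    · rw [hn]; exact kn
  linarith

/-- Let `X` be an infinite compact space with a minimal free action `φ` of
`ℤ^d`, and let `v` be a unitary in `C(X) ⋊_φ ℤ^d` with `v C(X) v* = C(X)`. Then there
exist pairwise orthogonal projections `(p_g)` in `C(X)`, only finitely many nonzero,
with `Σ_g p_g = 1`, and a unitary `f ∈ C(X)` such that `v = f Σ_g p_g U_φ^g`. -/
theorem stmt_9 {d : ℕ} {X : Type*} [TopologicalSpace X] [CompactSpace X] [T2Space X]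
    [Infinite X]
    (φ : (Fin d → ℤ) → X ≃ₜ X)
    (hφadd : ∀ v w x, φ (v + w) x = φ v (φ w x))
    (hφmin : ∀ x : X, Dense {y | ∃ v, φ v x = y})
    (hφfree : ∀ (v) (x : X), φ v x = x → v = 0)
    -- the crossed product C(X) ⋊_φ ℤ^d
    {A : Type*} [NormedRing A] [StarRing A] [CStarRing A] [NormedAlgebra ℂ A]
    [StarModule ℂ A] [CompleteSpace A]
    (ι : C(X, ℂ) →⋆ₐ[ℂ] A) (U : (Fin d → ℤ) → A)
    (hA : IsUniversalCrossedProduct φ ι U) (hι : Function.Injective ι)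
    (v : A) (hv : v ∈ unitary A)
    (hnorm : (fun a => v * a * star v) '' Set.range ⇑ι = Set.range ⇑ι) :
    ∃ (p : (Fin d → ℤ) → C(X, ℂ)) (f : C(X, ℂ)),
      (∀ g, IsSelfAdjoint (p g) ∧ p g * p g = p g) ∧
      (∀ g h, g ≠ h → p g * p h = 0) ∧
      {g | p g ≠ 0}.Finite ∧
      (∑ᶠ g, p g) = 1 ∧
      f ∈ unitary C(X, ℂ) ∧
      v = ι f * ∑ᶠ g, ι (p g) * U g := by
  classical
  have hcov := hA.1
  obtain ⟨hvl, hvr⟩ := Unitary.mem_iff.1 hv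
  have hiso : Isometry ι := by
    let _ : CStarAlgebra A := {}
    exact NonUnitalStarAlgHom.isometry ι hι
  have hex : ∀ f, ∃ k, ι k = v * ι f * star v := by
    intro f
    have : v * ι f * star v ∈ Set.range ι := by
      rw [← hnorm]
      exact ⟨ι f, ⟨f, rfl⟩, rfl⟩
    exact this
  choose α₀ hα₀ using hex
  let α : C(X, ℂ) →ₐ[ℂ] C(X, ℂ) :=
    { toFun := α₀
      map_one' := hι (by rw [hα₀, map_one, mul_one, hvr])
      map_zero' := hι (by rw [hα₀, map_zero, mul_zero, zero_mul])
      map_add' := fun f g => hι (by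
        rw [map_add, hα₀, hα₀, hα₀, map_add, mul_add, add_mul])
      map_mul' := fun f g => hι (by
        rw [map_mul, hα₀, hα₀, hα₀, map_mul]
        calc v * (ι f * ι g) * star v = v * ι f * 1 * ι g * star v := by
              simp only [mul_assoc, one_mul]
          _ = _ := by rw [← hvl]; simp only [mul_assoc])
      commutes' := fun r => hι (by
        rw [hα₀, AlgHomClass.commutes, ← Algebra.commutes, mul_assoc, hvr, mul_one]) }
  have hα : ∀ f, v * ι f = ι (α f) * v := by
    intro f
    change _ = ι (α₀ f) * v
    rw [hα₀, mul_assoc _ (star v), hvl, mul_one]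
  obtain ⟨F, hF⟩ := aux_pointwise φ ι U hA hiso v hv α hα
  let E : (Fin d → ℤ) → Set X := fun g => {x | ∀ f, α f x = f (φ (-g) x)}
  have hEcl : ∀ g, IsClosed (E g) := by
    intro g
    have : E g = ⋂ f : C(X, ℂ), {x | α f x = f (φ (-g) x)} := by
      ext x
      simp [E]
    rw [this]
    exact isClosed_iInter fun f => isClosed_eq (α f).continuous
      (f.continuous.comp (φ (-g)).continuous)
  have hsep : ∀ y z : X, (∀ f : C(X, ℂ), f y = f z) → y = z := by
    intro y z h
    by_contra hne
    obtain ⟨f, f1, f0, -⟩ := aux_bump ({z}ᶜ) isOpen_compl_singleton y hne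
    have h1 := h f
    rw [f1, f0 z (by simp)] at h1
    exact one_ne_zero h1
  have hinj : ∀ g h x, φ (-g) x = φ (-h) x → g = h := by
    intro g h x hx
    have h1 : φ (h + -g) x = φ (h + -h) x := by rw [hφadd, hφadd, hx]
    rw [add_neg_cancel, aux_zero hφadd] at h1
    have h2 := hφfree _ _ h1
    rw [add_neg_eq_zero] at h2
    exact h2.symm
  have huniq : ∀ g h x, x ∈ E g → x ∈ E h → g = h := by
    intro g h x hg hh
    exact hinj g h x (hsep _ _ fun f => by rw [← hg f, ← hh f])
  have hEop : ∀ g, IsOpen (E g) := by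
    intro g
    have : E g = (⋃ h ∈ F.erase g, E h)ᶜ := by
      ext x
      simp only [Set.mem_compl_iff, Set.mem_iUnion, not_exists]
      constructor
      · intro hx h hh hxh
        exact (Finset.mem_erase.1 hh).1 (huniq _ _ _ hxh hx)
      · intro hx
        obtain ⟨h, hh, hxh⟩ := hF x
        by_cases hgh : h = g
        · rw [← hgh]; exact hxh
        · exact absurd hxh (hx h (Finset.mem_erase.2 ⟨hgh, hh⟩))
    rw [this]
    exact ((F.erase g).finite_toSet.isClosed_biUnion fun h _ => hEcl h).isOpen_compl
  have hEco : ∀ g, IsClopen (E g) := fun g => ⟨hEcl g, hEop g⟩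
  let p : (Fin d → ℤ) → C(X, ℂ) := fun g =>
    (LocallyConstant.charFn ℂ (hEco g)).toContinuousMap
  have hp : ∀ g x, p g x = if x ∈ E g then 1 else 0 := by
    intro g x
    change (LocallyConstant.charFn ℂ (hEco g)) x = _
    rw [LocallyConstant.coe_charFn, Set.indicator_apply]
    rfl
  have hpF : ∀ g, p g ≠ 0 → g ∈ F := by
    intro g hg
    by_contra hgF
    apply hg
    ext x
    rw [hp, if_neg]
    · rfl
    · intro hx
      obtain ⟨h, hh, hxh⟩ := hF x
      exact hgF (huniq _ _ _ hx hxh ▸ hh)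
  have hpsa : ∀ g, star (p g) = p g := by
    intro g
    ext x
    rw [ContinuousMap.star_apply, hp]
    split_ifs <;> simp
  have hpp : ∀ g, p g * p g = p g := by
    intro g
    ext x
    rw [ContinuousMap.mul_apply, hp]
    split_ifs <;> simp
  have hsum : ∑ g ∈ F, p g = 1 := by
    ext x
    obtain ⟨h, hh, hxh⟩ := hF x
    rw [ContinuousMap.sum_apply, Finset.sum_eq_single h]
    · rw [hp, if_pos (show x ∈ E h from hxh)]; rfl
    · intro g _ hgh
      rw [hp, if_neg]
      exact fun hx => hgh (huniq _ _ _ hx hxh)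
    · exact fun h' => absurd hh h'
  have hfs : ∑ᶠ g, p g = ∑ g ∈ F, p g :=
    finsum_eq_sum_of_support_subset _ fun g hg => hpF g hg
  have hfu : ∑ᶠ g, ι (p g) * U g = ∑ g ∈ F, ι (p g) * U g := by
    refine finsum_eq_sum_of_support_subset _ fun g hg => hpF g fun h0 => hg ?_
    beta_reduce
    rw [h0, map_zero, zero_mul]
  set u : A := ∑ g ∈ F, ι (p g) * U g with hu
  have huf : ∀ f, u * ι f = ι (α f) * u := by
    intro f
    rw [hu, Finset.sum_mul, Finset.mul_sum]
    refine Finset.sum_congr rfl fun g _ => ?_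
    rw [mul_assoc, aux_comm hcov, ← mul_assoc, ← mul_assoc, ← map_mul, ← map_mul]
    congr 2
    ext x
    rw [ContinuousMap.mul_apply, ContinuousMap.mul_apply, hp, auxT_apply]
    split_ifs with hx
    · rw [hx f]; ring
    · simp
  have huu : u * star u = 1 := by
    rw [hu, star_sum, Finset.sum_mul]
    have : ∀ g ∈ F, ι (p g) * U g * ∑ h ∈ F, star (ι (p h) * U h) = ι (p g) := by
      intro g hg
      have key : ∀ h, ι (p g) * U g * star (ι (p h) * U h)
          = ι (p g * auxT φ (g + -h) (p h)) * U (g + -h) := by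
        intro h
        rw [star_mul, ← map_star, hpsa, aux_star hcov, map_mul, mul_assoc (ι (p g)) _ (U (g + -h)),
          ← aux_comm hcov, hcov.2.2.1]
        simp only [mul_assoc]
      rw [Finset.mul_sum, Finset.sum_eq_single g]
      · rw [key, add_neg_cancel, hcov.2.1, mul_one]
        congr 1
        ext x
        rw [ContinuousMap.mul_apply, auxT_apply, neg_zero, aux_zero hφadd,
          ← ContinuousMap.mul_apply, hpp]
      · intro h _ hhg
        rw [key]
        have : p g * auxT φ (g + -h) (p h) = 0 := by
          ext x
          rw [ContinuousMap.mul_apply, auxT_apply, hp, hp, ContinuousMap.zero_apply]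
          by_cases hx : x ∈ E g
          · rw [if_pos hx, if_neg, mul_zero]
            intro hx'
            apply hhg
            have hpt : φ (-(g + -h)) x = x := by
              apply hsep
              intro f
              obtain ⟨f', rfl⟩ : ∃ f', α f' = f := by
                have : ι f ∈ (fun a => v * a * star v) '' Set.range ⇑ι := by
                  rw [hnorm]; exact ⟨f, rfl⟩
                obtain ⟨_, ⟨f', rfl⟩, hf'⟩ := this
                exact ⟨f', hι ((hα₀ f').trans hf')⟩
              rw [hx f', hx' f', ← hφadd]
              congr 2
              abel_nf
            have := hφfree _ _ hpt
            rw [neg_eq_zero, add_neg_eq_zero] at this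
            exact this.symm
          · rw [if_neg hx, zero_mul]
        rw [this, map_zero, zero_mul]
      · exact fun h => absurd hg h
    rw [Finset.sum_congr rfl this, ← map_sum, hsum, map_one]
  have hvs : ∀ f, ι f * star v = star v * ι (α f) := by
    intro f
    calc ι f * star v = star v * (v * ι f) * star v := by rw [← mul_assoc, hvl, one_mul]
      _ = star v * ι (α f) := by rw [hα]; simp only [mul_assoc]; rw [hvr, mul_one]
  obtain ⟨k, hk⟩ := aux_masa φ hφadd hφfree ι U hA hiso (star v * u) (by
    intro f
    rw [mul_assoc, huf, ← mul_assoc, ← mul_assoc, hvs])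
  have huk : u = ι (α k) * v := by
    rw [← hα, ← hk, ← mul_assoc, hvr, one_mul]
  have hun : α k * star (α k) = 1 := by
    apply hι
    rw [map_one, ← huu, huk, star_mul, map_mul, map_star]
    calc ι (α k) * star (ι (α k)) = ι (α k) * 1 * star (ι (α k)) := by rw [mul_one]
      _ = _ := by rw [← hvr]; simp only [mul_assoc]
  refine ⟨p, star (α k), fun g => ⟨hpsa g, hpp g⟩, ?_, ?_, by rw [hfs, hsum], ?_, ?_⟩
  · intro g h hgh
    ext x
    rw [ContinuousMap.mul_apply, hp, hp, ContinuousMap.zero_apply]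
    split_ifs with h1 h2
    · exact absurd (huniq _ _ _ h1 h2) hgh
    all_goals simp
  · exact F.finite_toSet.subset fun g hg => hpF g hg
  · rw [Unitary.mem_iff, star_star]
    exact ⟨hun, by rw [mul_comm]; exact hun⟩
  · rw [hfu, huk, ← mul_assoc, ← map_mul, mul_comm (star _), hun, map_one, one_mul]
end

section
/- Let (X, φ, ℤ^d) be a minimal Cantor system with dynamical cohomology group (G(φ), G(φ)_+). Then (G(φ), G(φ)_+) is weakly unperforated: if n ∈ ℤ, n ≥ 1, and [f] ∈ G(φ) satisfies n[f] > 0, then [f] > 0. -/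
/-- The subgroup `B(φ) ⊆ C(X, ℤ)` of `φ`-coboundaries, generated by the functions
`g - g ∘ φ^v` (equivalently by `1_A - 1_{φ^v A}` for clopen `A`). -/
def cobSubgroup {d : ℕ} {X : Type*} [TopologicalSpace X]
    (φ : (Fin d → ℤ) → X ≃ₜ X) : AddSubgroup C(X, ℤ) :=
  AddSubgroup.closure
    {f | ∃ (g : C(X, ℤ)) (v : Fin d → ℤ), f = g - g.comp ⟨⇑(φ v), (φ v).continuous⟩}

/-- The positive cone `G(φ)₊` of the dynamical cohomology group
`G(φ) = C(X, ℤ) / B(φ)`: classes of pointwise nonnegative functions. -/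
def posCone {d : ℕ} {X : Type*} [TopologicalSpace X] (φ : (Fin d → ℤ) → X ≃ₜ X) :
    Set (C(X, ℤ) ⧸ cobSubgroup φ) :=
  {a | ∃ f : C(X, ℤ), (∀ x, 0 ≤ f x) ∧
    (QuotientAddGroup.mk f : C(X, ℤ) ⧸ cobSubgroup φ) = a}

open scoped Classical in
/-- Number of `Q`-edges from `F` to points outside `F` satisfying `s`. -/
noncomputable def edg {d : ℕ} (Q : Finset (Fin d → ℤ)) (s : (Fin d → ℤ) → Prop)
    (F : Finset (Fin d → ℤ)) : ℤ :=
  ∑ u ∈ F, ∑ q ∈ Q, if u + q ∉ F ∧ s (u + q) then 1 else 0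

/-- The box of radius `N`. -/
noncomputable def bx (d N : ℕ) : Finset (Fin d → ℤ) := Finset.Icc (fun _ => -(N : ℤ)) (fun _ => (N : ℤ))

lemma mem_bx {d N : ℕ} {v : Fin d → ℤ} : v ∈ bx d N ↔ ∀ i, |v i| ≤ N := by
  simp only [bx, Finset.mem_Icc, Pi.le_def, abs_le]
  exact ⟨fun h i => ⟨h.1 i, h.2 i⟩, fun h => ⟨fun i => (h i).1, fun i => (h i).2⟩⟩

lemma bx_neg {d N : ℕ} {v : Fin d → ℤ} (h : v ∈ bx d N) : -v ∈ bx d N := by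
  rw [mem_bx] at *; simpa using h

lemma bx_zero {d N : ℕ} : (0 : Fin d → ℤ) ∈ bx d N := by
  rw [mem_bx]; simp

lemma bx_add {d N M : ℕ} {v w : Fin d → ℤ} (h : v ∈ bx d N) (h' : w ∈ bx d M) :
    v + w ∈ bx d (N + M) := by
  rw [mem_bx] at *
  intro i
  have := abs_add_le (v i) (w i)
  have := h i
  have := h' i
  push_cast
  simp only [Pi.add_apply]
  linarith

lemma bx_mono {d N M : ℕ} (h : N ≤ M) : bx d N ⊆ bx d M := by
  intro v hv
  rw [mem_bx] at *
  intro i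
  have := hv i
  have : (N : ℤ) ≤ M := by exact_mod_cast h
  linarith

lemma bx_card {d N : ℕ} : (bx d N).card = (2 * N + 1) ^ d := by
  rw [bx, Pi.card_Icc]
  simp only [Int.card_Icc, Finset.prod_const, Finset.card_univ, Fintype.card_fin]
  congr 1
  omega

lemma exists_bx {d : ℕ} (t : Finset (Fin d → ℤ)) : ∃ N, t ⊆ bx d N := by
  classical
  induction t using Finset.induction_on with
  | empty => exact ⟨0, by simp⟩
  | insert a s ha ih =>
    obtain ⟨N, hN⟩ := ih
    refine ⟨N + ∑ i, (a i).natAbs, ?_⟩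
    intro v hv
    rcases Finset.mem_insert.1 hv with rfl | hv
    · rw [mem_bx]
      intro i
      have : (v i).natAbs ≤ ∑ i, (v i).natAbs := Finset.single_le_sum (f := fun i => (v i).natAbs) (fun _ _ => Nat.zero_le _)
        (Finset.mem_univ i)
      rw [Int.abs_eq_natAbs]
      exact_mod_cast this.trans (Nat.le_add_left _ _)
    · exact bx_mono (Nat.le_add_right _ _) (hN hv)

lemma edg_nonneg {d : ℕ} (Q : Finset (Fin d → ℤ)) (s : (Fin d → ℤ) → Prop)
    (F : Finset (Fin d → ℤ)) : 0 ≤ edg Q s F := by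
  unfold edg
  refine Finset.sum_nonneg fun u _ => Finset.sum_nonneg fun q _ => ?_
  split_ifs <;> norm_num

lemma edg_mono {d : ℕ} {Q Q' : Finset (Fin d → ℤ)} (h : Q ⊆ Q') (s : (Fin d → ℤ) → Prop)
    (F : Finset (Fin d → ℤ)) : edg Q s F ≤ edg Q' s F := by
  unfold edg
  refine Finset.sum_le_sum fun u _ => Finset.sum_le_sum_of_subset_of_nonneg h fun q _ _ => ?_
  split_ifs <;> norm_num

lemma growth (d N W : ℕ) (hW : 1 ≤ W) :
    ∃ j : ℕ, (((2 * (j * N) + 1) ^ d : ℕ) : ℝ) < (1 + 1 / (W : ℝ)) ^ j := by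
  have hr : (1 : ℝ) < 1 + 1 / (W : ℝ) := by
    have : (0 : ℝ) < W := by exact_mod_cast hW
    have : 0 < 1 / (W : ℝ) := by positivity
    linarith
  have ht := tendsto_pow_const_div_const_pow_of_one_lt d hr
  have hc : (0 : ℝ) < 1 / ((2 * N + 1 : ℝ) ^ d) := by positivity
  obtain ⟨j, hj, hj1⟩ := ((ht.eventually (gt_mem_nhds hc)).and
    (Filter.eventually_ge_atTop 1)).exists
  refine ⟨j, ?_⟩
  rw [div_lt_div_iff₀ (by positivity) (by positivity)] at hj
  have hj1' : (1 : ℝ) ≤ j := by exact_mod_cast hj1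
  calc (((2 * (j * N) + 1) ^ d : ℕ) : ℝ) = (2 * (j * N) + 1 : ℝ) ^ d := by push_cast; ring
    _ ≤ (j * (2 * N + 1) : ℝ) ^ d := by
        apply pow_le_pow_left₀ (by positivity)
        nlinarith
    _ = (j : ℝ) ^ d * (2 * N + 1) ^ d := by rw [mul_pow]
    _ < _ := by linarith

lemma edg_le {d N j : ℕ} (P F F' : Finset (Fin d → ℤ))
    (hF : ∀ v, v ∈ F ↔ v ∈ P ∧ v ∈ bx d (j * N))
    (hF' : ∀ v, v ∈ F' ↔ v ∈ P ∧ v ∈ bx d ((j + 1) * N)) :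
    edg (bx d N) (· ∈ P) F ≤ (bx d N).card * ((F'.card : ℤ) - F.card) := by
  classical
  have hsub : F ⊆ F' := by
    intro v hv
    rw [hF] at hv
    rw [hF']
    exact ⟨hv.1, bx_mono (Nat.mul_le_mul_right _ (Nat.le_succ _)) hv.2⟩
  unfold edg
  rw [Finset.sum_comm]
  have hc : ((F'.card : ℤ) - F.card) = (F' \ F).card := by
    have := Finset.card_sdiff_add_card_eq_card hsub
    omega
  rw [hc, ← nsmul_eq_mul, ← Finset.sum_const]
  refine Finset.sum_le_sum fun q hq => ?_
  have hcard : (∑ u ∈ F, if u + q ∉ F ∧ (fun x => x ∈ P) (u + q) then (1 : ℤ) else 0) =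
      ((F.filter (fun u => u + q ∉ F ∧ u + q ∈ P)).card : ℤ) := by
    rw [Finset.card_filter]
    push_cast
    exact Finset.sum_congr rfl fun u _ => by congr
  refine le_trans (le_of_eq ?_) (le_trans (le_of_eq hcard) ?_)
  · exact Finset.sum_congr rfl fun u _ => by congr
  norm_cast
  apply Finset.card_le_card_of_injOn (fun u => u + q)
  · intro u hu
    simp only [Finset.coe_filter, Set.mem_setOf_eq] at hu
    simp only [Finset.coe_sdiff, Set.mem_diff, Finset.mem_coe]
    refine ⟨?_, hu.2.1⟩
    rw [hF']
    refine ⟨hu.2.2, ?_⟩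
    have := bx_add ((hF u).1 hu.1).2 hq
    rwa [add_mul, one_mul]
  · intro a _ b _ h
    simpa using h

/-- Ball carving: subexponential growth gives a set with small boundary inside `P`. -/
lemma carve (d N L : ℕ) : ∃ R : ℕ, ∀ P : Finset (Fin d → ℤ), 0 ∈ P →
    ∃ D : Finset (Fin d → ℤ), D ⊆ P ∧ D ⊆ bx d R ∧ 0 ∈ D ∧
      L * edg (bx d N) (· ∈ P) D ≤ D.card := by
  classical
  set W : ℕ := L * (bx d N).card + 1 with hWdef
  obtain ⟨J, hJ⟩ := growth d N W (by omega)
  refine ⟨J * N, fun P hP => ?_⟩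
  by_contra hcon
  push Not at hcon
  set Fj : ℕ → Finset (Fin d → ℤ) := fun j => P.filter (· ∈ bx d (j * N)) with hFj
  have hmem : ∀ j v, v ∈ Fj j ↔ v ∈ P ∧ v ∈ bx d (j * N) := by
    intro j v; simp [hFj]
  have hW0 : (0 : ℝ) < W := by exact_mod_cast Nat.succ_pos _
  have key : ∀ j, j ≤ J → (1 + 1 / (W : ℝ)) ^ j ≤ (Fj j).card := by
    intro j
    induction j with
    | zero =>
      intro _
      have : 0 < (Fj 0).card := Finset.card_pos.2 ⟨0, (hmem _ _).2 ⟨hP, bx_zero⟩⟩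
      simp only [pow_zero]
      exact_mod_cast this
    | succ j ih =>
      intro hj
      have ih := ih (by omega)
      have h1 := hcon (Fj j) (fun v hv => ((hmem _ _).1 hv).1)
        (fun v hv => bx_mono (Nat.mul_le_mul_right _ (by omega)) ((hmem _ _).1 hv).2)
        ((hmem _ _).2 ⟨hP, bx_zero⟩)
      have h2 := edg_le P (Fj j) (Fj (j + 1)) (hmem _) (hmem _)
      have h0 : (0 : ℤ) ≤ ((Fj (j + 1)).card : ℤ) - (Fj j).card := by
        have : Fj j ⊆ Fj (j + 1) := fun v hv =>
          (hmem _ _).2 ⟨((hmem _ _).1 hv).1, bx_mono (Nat.mul_le_mul_right _ (Nat.le_succ _))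
            ((hmem _ _).1 hv).2⟩
        have := Finset.card_le_card this
        omega
      have h3 : ((Fj j).card : ℤ) ≤ W * (((Fj (j + 1)).card : ℤ) - (Fj j).card) := by
        have h4 : (L : ℤ) * edg (bx d N) (· ∈ P) (Fj j) ≤
          L * ((bx d N).card * (((Fj (j + 1)).card : ℤ) - (Fj j).card)) :=
          mul_le_mul_of_nonneg_left h2 (by positivity)
        rw [hWdef]
        push_cast
        nlinarith
      have h5 : ((Fj j).card : ℝ) ≤ W * (((Fj (j + 1)).card : ℝ) - (Fj j).card) := by
        exact_mod_cast h3
      rw [pow_succ]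
      calc _ ≤ ((Fj j).card : ℝ) * (1 + 1 / (W : ℝ)) := by gcongr
        _ ≤ _ := by
          rw [mul_add, mul_one, mul_one_div]
          have : ((Fj j).card : ℝ) / W ≤ ((Fj (j + 1)).card : ℝ) - (Fj j).card := by
            rw [div_le_iff₀ hW0]; linarith
          linarith
  have h1 := key J le_rfl
  have h2 : (Fj J).card ≤ (2 * (J * N) + 1) ^ d := by
    rw [← bx_card]
    exact Finset.card_le_card fun v hv => ((hmem _ _).1 hv).2
  have h3 : ((Fj J).card : ℝ) ≤ (((2 * (J * N) + 1) ^ d : ℕ) : ℝ) := by exact_mod_cast h2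
  linarith

/-- A plain function which is a coboundary. -/
def Cob {d : ℕ} {X : Type*} [TopologicalSpace X] (φ : (Fin d → ℤ) → X ≃ₜ X) (h : X → ℤ) : Prop :=
  ∃ hc : Continuous h, (⟨h, hc⟩ : C(X, ℤ)) ∈ cobSubgroup φ

lemma Cob.add {d : ℕ} {X : Type*} [TopologicalSpace X] {φ : (Fin d → ℤ) → X ≃ₜ X} {h k : X → ℤ}
    (hh : Cob φ h) (hk : Cob φ k) : Cob φ (fun x => h x + k x) := by
  obtain ⟨c, hc⟩ := hh
  obtain ⟨c', hc'⟩ := hk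
  exact ⟨c.add c', (cobSubgroup φ).add_mem hc hc'⟩

lemma Cob.zero {d : ℕ} {X : Type*} [TopologicalSpace X] {φ : (Fin d → ℤ) → X ≃ₜ X} :
    Cob φ (fun _ => 0) :=
  ⟨continuous_const, (cobSubgroup φ).zero_mem⟩

lemma Cob.neg {d : ℕ} {X : Type*} [TopologicalSpace X] {φ : (Fin d → ℤ) → X ≃ₜ X} {h : X → ℤ}
    (hh : Cob φ h) : Cob φ (fun x => - h x) := by
  obtain ⟨c, hc⟩ := hh
  exact ⟨c.neg, (cobSubgroup φ).neg_mem hc⟩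

lemma Cob.sum {d : ℕ} {X : Type*} [TopologicalSpace X] {φ : (Fin d → ℤ) → X ≃ₜ X} {ι : Type*}
    (s : Finset ι) (h : ι → X → ℤ) (hh : ∀ i ∈ s, Cob φ (h i)) :
    Cob φ (fun x => ∑ i ∈ s, h i x) := by
  classical
  induction s using Finset.induction_on with
  | empty => simpa using Cob.zero
  | insert a s ha ih =>
    simp only [Finset.sum_insert ha]
    exact (hh a (by simp)).add (ih fun i hi => hh i (Finset.mem_insert_of_mem hi))

lemma Cob.basic {d : ℕ} {X : Type*} [TopologicalSpace X] {φ : (Fin d → ℤ) → X ≃ₜ X} {g : X → ℤ}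
    (hg : Continuous g) (v : Fin d → ℤ) : Cob φ (fun x => g x - g (φ v x)) :=
  ⟨hg.sub (hg.comp (φ v).continuous), AddSubgroup.subset_closure ⟨⟨g, hg⟩, v, rfl⟩⟩

open scoped Classical in
/-- Integer indicator. -/
noncomputable def ind {X : Type*} (S : Set X) (x : X) : ℤ := if x ∈ S then 1 else 0

lemma ind_cont {X : Type*} [TopologicalSpace X] {S : Set X} (hS : IsClopen S) :
    Continuous (ind S) := by
  classical
  unfold ind
  exact continuous_const.if (by simp [hS.frontier_eq]) continuous_const

/-- The invariant. -/
def CarveInv {d : ℕ} {X : Type*} [TopologicalSpace X] (φ : (Fin d → ℤ) → X ≃ₜ X) (N : ℕ) (m K : ℤ)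
    (S : Set X) (f : X → ℤ) : Prop :=
  ∀ x (F : Finset (Fin d → ℤ)), (∀ u ∈ F, φ u x ∈ S) →
    (F.card : ℤ) ≤ m * (∑ u ∈ F, f (φ u x) + K * edg (bx d N) (fun u => φ u x ∈ S) F)

lemma step {d : ℕ} {X : Type*} [TopologicalSpace X] (φ : (Fin d → ℤ) → X ≃ₜ X)
    (hadd : ∀ v w x, φ (v + w) x = φ v (φ w x)) (hzero : ∀ x, φ 0 x = x)
    (N R : ℕ) (m K : ℤ) (hm : 1 ≤ m) (hK : 0 ≤ K)
    (hR : ∀ P : Finset (Fin d → ℤ), 0 ∈ P →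
      ∃ D : Finset (Fin d → ℤ), D ⊆ P ∧ D ⊆ bx d R ∧ 0 ∈ D ∧
      (2 * m * K) * edg (bx d N) (· ∈ P) D ≤ D.card)
    (C : Set X) (hC : IsClopen C)
    (hsep : ∀ c ∈ C, ∀ v ∈ bx d (R + R), v ≠ 0 → φ v c ∉ C)
    (S : Set X) (hS : IsClopen S) (f : X → ℤ) (hf : Continuous f) (hI : CarveInv φ N m K S f) :
    ∃ (S' : Set X) (f' g : X → ℤ), IsClopen S' ∧ S' ⊆ S ∧ Disjoint S' C ∧ Continuous f' ∧
      CarveInv φ N m K S' f' ∧ Continuous g ∧ (∀ x, 0 ≤ g x) ∧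
      Cob φ (fun x => ind S x * f x - ind S' x * f' x - g x) := by
  classical
  choose! D hDP hDR hD0 hDe using hR
  have hcancel : ∀ v x, φ v (φ (-v) x) = x := fun v x => by rw [← hadd]; simp [hzero]
  have hcancel' : ∀ v x, φ (-v) (φ v x) = x := fun v x => by rw [← hadd]; simp [hzero]
  -- local patterns
  set P : X → Finset (Fin d → ℤ) := fun c => (bx d (R + N)).filter (fun v => φ v c ∈ S) with hP
  have hPmem : ∀ c v, v ∈ P c ↔ v ∈ bx d (R + N) ∧ φ v c ∈ S := by
    intro c v; simp [hP]
  have hPlc : ∀ t : Finset (Fin d → ℤ), IsClopen {c | P c = t} := by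
    intro t
    by_cases ht : t ⊆ bx d (R + N)
    · have : {c | P c = t} = ⋂ v ∈ bx d (R + N), {c | φ v c ∈ S ↔ v ∈ t} := by
        ext c
        simp only [Set.mem_ofPred_eq, Set.mem_iInter]
        constructor
        · rintro rfl v hv
          rw [hPmem]
          tauto
        · intro h
          ext v
          rw [hPmem]
          constructor
          · rintro ⟨h1, h2⟩
            exact (h v h1).1 h2
          · intro h1
            exact ⟨ht h1, (h v (ht h1)).2 h1⟩
      rw [this]
      apply isClopen_biInter_finset
      intro v _
      by_cases hv : v ∈ t
      · simp only [hv, iff_true]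
        exact hS.preimage (φ v).continuous
      · simp only [hv, iff_false]
        exact (hS.preimage (φ v).continuous).compl
    · convert isClopen_empty
      ext c
      simp only [Set.mem_ofPred_eq, Set.mem_empty_iff_false, iff_false]
      rintro rfl
      exact ht (Finset.filter_subset _ _)
  set A : (Fin d → ℤ) → Set X := fun v => {c | c ∈ C ∧ c ∈ S ∧ v ∈ D (P c)} with hA
  have hAc : ∀ v, IsClopen (A v) := by
    intro v
    have : A v = C ∩ (S ∩ ⋃ t ∈ (bx d (R + N)).powerset.filter (fun t => v ∈ D t),
        {c | P c = t}) := by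
      ext c
      simp only [hA, Set.mem_ofPred_eq, Set.mem_inter_iff, Set.mem_iUnion, Finset.mem_filter,
        Finset.mem_powerset]
      constructor
      · rintro ⟨h1, h2, h3⟩
        exact ⟨h1, h2, P c, ⟨Finset.filter_subset _ _, h3⟩, rfl⟩
      · rintro ⟨h1, h2, t, ⟨_, h3⟩, rfl⟩
        exact ⟨h1, h2, h3⟩
    rw [this]
    refine hC.inter (hS.inter ?_)
    apply Set.Finite.isClopen_biUnion (Finset.finite_toSet _)
    intro t _
    exact hPlc t
  have hP0 : ∀ c ∈ S, (0 : Fin d → ℤ) ∈ P c := fun c hc =>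
    (hPmem _ _).2 ⟨bx_zero, by rwa [hzero]⟩
  have hAB : ∀ v c, c ∈ A v → v ∈ bx d R := fun v c hc => hDR _ (hP0 _ hc.2.1) hc.2.2
  have hAS : ∀ v c, c ∈ A v → φ v c ∈ S := fun v c hc =>
    ((hPmem _ _).1 (hDP _ (hP0 _ hc.2.1) hc.2.2)).2
  -- the tiles are disjoint
  have hdisj : ∀ v w y, φ (-v) y ∈ A v → φ (-w) y ∈ A w → v = w := by
    intro v w y hv hw
    by_contra hne
    have h1 : φ (v - w) (φ (-v) y) = φ (-w) y := by
      rw [← hadd]; congr 1; congr 1; abel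
    refine hsep _ hv.1 (v - w) ?_ (sub_ne_zero.2 hne) (h1 ▸ hw.1)
    rw [sub_eq_add_neg]
    exact bx_add (hAB _ _ hv) (bx_neg (hAB _ _ hw))
  set T : Set X := ⋃ v ∈ bx d R, (φ (-v)) ⁻¹' (A v) with hT
  have hTc : IsClopen T :=
    Set.Finite.isClopen_biUnion (Finset.finite_toSet _)
      fun v _ => (hAc v).preimage (φ (-v)).continuous
  have hTmem : ∀ y, y ∈ T ↔ ∃ v, φ (-v) y ∈ A v := by
    intro y
    simp only [hT, Set.mem_iUnion, Set.mem_preimage]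
    exact ⟨fun ⟨v, _, h⟩ => ⟨v, h⟩, fun ⟨v, h⟩ => ⟨v, hAB _ _ h, h⟩⟩
  have hTS : T ⊆ S := by
    intro y hy
    obtain ⟨v, hv⟩ := (hTmem y).1 hy
    have := hAS _ _ hv
    rwa [hcancel] at this
  have hTind : ∀ y, ind T y = ∑ v ∈ bx d R, ind (A v) (φ (-v) y) := by
    intro y
    by_cases hy : y ∈ T
    · obtain ⟨v, hv⟩ := (hTmem y).1 hy
      rw [Finset.sum_eq_single v]
      · simp [ind, hy, hv]
      · intro w _ hwv
        unfold ind
        rw [if_neg]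
        exact fun hw => hwv (hdisj _ _ _ hw hv)
      · exact fun h => absurd (hAB _ _ hv) h
    · rw [Finset.sum_eq_zero]
      · simp [ind, hy]
      · intro w _
        unfold ind
        rw [if_neg]
        exact fun hw => hy ((hTmem y).2 ⟨w, hw⟩)
  set S' : Set X := S \ T with hS'
  have hS'c : IsClopen S' := hS.diff hTc
  set Q := bx d N with hQ
  set f' : X → ℤ := fun y => f y + K * ∑ q ∈ Q, ind T (φ q y) with hf'
  set ft : X → ℤ := fun y => f y - K * ∑ q ∈ Q, ind S' (φ q y) with hft
  have hcf' : Continuous f' := hf.add (continuous_const.mul (continuous_finsetSum _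
    fun q _ => (ind_cont hTc).comp (φ q).continuous))
  have hcft : Continuous ft := hf.sub (continuous_const.mul (continuous_finsetSum _
    fun q _ => (ind_cont hS'c).comp (φ q).continuous))
  set g : X → ℤ := fun c => ∑ v ∈ bx d R, ind (A v) c * ft (φ v c) with hg
  have hcg : Continuous g := continuous_finsetSum _
    fun v _ => (ind_cont (hAc v)).mul (hcft.comp (φ v).continuous)
  have hSind : ∀ y, ind S y = ind T y + ind S' y := by
    intro y
    have := @hTS y
    by_cases h1 : y ∈ T <;> by_cases h2 : y ∈ S <;> simp [ind, hS', h1, h2] <;> tauto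
  have hind0 : ∀ (U : Set X) y, 0 ≤ ind U y := by
    intro U y; unfold ind; split_ifs <;> norm_num
  refine ⟨S', f', g, hS'c, Set.sdiff_subset, ?_, hcf', ?_, hcg, ?_, ?_⟩
  · rw [Set.disjoint_left]
    intro c hc hcC
    apply hc.2
    rw [hTmem]
    refine ⟨0, ?_⟩
    rw [neg_zero, hzero]
    exact ⟨hcC, hc.1, hD0 _ (hP0 _ hc.1)⟩
  · -- invariant
    intro x F hF
    have h1 := hI x F (fun u hu => (hF u hu).1)
    refine h1.trans (mul_le_mul_of_nonneg_left ?_ (by linarith))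
    simp only [hf', Finset.sum_add_distrib, ← Finset.mul_sum]
    rw [add_assoc, ← mul_add]
    gcongr
    unfold edg
    rw [← Finset.sum_add_distrib]
    refine Finset.sum_le_sum fun u hu => ?_
    rw [← Finset.sum_add_distrib]
    refine Finset.sum_le_sum fun q hq => ?_
    rw [← hadd, add_comm q u]
    by_cases h2 : φ (u + q) x ∈ S
    · by_cases h3 : φ (u + q) x ∈ T
      · simp only [ind, h3, if_true]
        split_ifs <;> norm_num
      · by_cases h4 : u + q ∈ F
        · simp [ind, h3, h4]
        · simp [ind, h3, h4, h2, hS']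
    · simp only [h2, and_false, if_false]
      have := hind0 T (φ (u + q) x)
      split_ifs <;> linarith
  · -- tile sums are nonnegative
    intro c
    by_cases hc : c ∈ C ∧ c ∈ S
    · have hD1 := hDR _ (hP0 c hc.2)
      have hgc : g c = ∑ v ∈ D (P c), ft (φ v c) := by
        simp only [hg]
        rw [← Finset.sum_subset hD1]
        · refine Finset.sum_congr rfl fun v hv => ?_
          simp [ind, hA, hc.1, hc.2, hv]
        · intro v _ hv
          simp [ind, hA, hv]
      have hmemS : ∀ u ∈ D (P c), φ u c ∈ S := fun u hu => hAS u c ⟨hc.1, hc.2, hu⟩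
      have h1 := hI c (D (P c)) hmemS
      have h2 : edg Q (fun u => φ u c ∈ S) (D (P c)) = edg Q (· ∈ P c) (D (P c)) := by
        unfold edg
        refine Finset.sum_congr rfl fun u hu => Finset.sum_congr rfl fun q hq => ?_
        have : u + q ∈ P c ↔ φ (u + q) c ∈ S := by
          rw [hPmem]
          exact and_iff_right (bx_add (hD1 hu) hq)
        simp only [this]
      have h3 := hDe _ (hP0 c hc.2)
      have h4 : ∑ v ∈ D (P c), ∑ q ∈ Q, ind S' (φ q (φ v c)) ≤
          edg Q (fun u => φ u c ∈ S) (D (P c)) := by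
        unfold edg
        refine Finset.sum_le_sum fun u hu => Finset.sum_le_sum fun q hq => ?_
        rw [← hadd, add_comm q u]
        by_cases h5 : φ (u + q) c ∈ S'
        · have h6 : u + q ∉ D (P c) := by
            intro h7
            apply h5.2
            rw [hTmem]
            refine ⟨u + q, ?_⟩
            rw [hcancel']
            exact ⟨hc.1, hc.2, h7⟩
          simp [ind, h5, h6, h5.1]
        · simp only [ind, h5, if_false]
          split_ifs <;> norm_num
      have h5 : g c = ∑ v ∈ D (P c), f (φ v c) -
          K * ∑ v ∈ D (P c), ∑ q ∈ Q, ind S' (φ q (φ v c)) := by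
        rw [hgc]
        simp only [hft, Finset.sum_sub_distrib, ← Finset.mul_sum]
      have h6 := mul_le_mul_of_nonneg_left h4 hK
      have h7 : ∑ v ∈ D (P c), f (φ v c) - K * edg Q (fun u => φ u c ∈ S) (D (P c)) ≤ g c := by
        linarith
      have h8 := mul_le_mul_of_nonneg_left h7 (by linarith : (0 : ℤ) ≤ m)
      rw [← h2] at h3
      have h9 : 0 ≤ m * g c := by nlinarith
      exact nonneg_of_mul_nonneg_right h9 (by linarith)
    · have : g c = 0 := by
        apply Finset.sum_eq_zero
        intro v _
        have : c ∉ A v := fun h => hc ⟨h.1, h.2.1⟩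
        simp [ind, this]
      rw [this]
  · -- cohomology
    have e1 : Cob φ (fun y => ∑ v ∈ bx d R, -((ind (A v) y * ft (φ v y)) -
        (ind (A v) (φ (-v) y) * ft (φ v (φ (-v) y))))) := by
      apply Cob.sum
      intro v _
      apply Cob.neg
      exact Cob.basic (g := fun y => ind (A v) y * ft (φ v y))
        ((ind_cont (hAc v)).mul (hcft.comp (φ v).continuous)) (-v)
    have e2 : Cob φ (fun y => ∑ q ∈ Q, ((K * (ind T y * ind S' (φ q y))) -
        (K * (ind T (φ (-q) y) * ind S' (φ q (φ (-q) y)))))) := by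
      apply Cob.sum
      intro q _
      exact Cob.basic (g := fun y => K * (ind T y * ind S' (φ q y)))
        (continuous_const.mul ((ind_cont hTc).mul ((ind_cont hS'c).comp (φ q).continuous))) (-q)
    convert e1.add e2 using 2 with y
    simp only [hcancel]
    have hre : ∑ q ∈ Q, ind T (φ (-q) y) = ∑ q ∈ Q, ind T (φ q y) := by
      apply Finset.sum_nbij' (fun q => -q) (fun q => -q)
      · intro q hq; exact bx_neg hq
      · intro q hq; exact bx_neg hq
      · simp
      · simp
      · simp
    have r1 : ∑ v ∈ bx d R, -((ind (A v) y * ft (φ v y)) - (ind (A v) (φ (-v) y) * ft y)) =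
        ind T y * ft y - g y := by
      rw [hTind, Finset.sum_mul]
      simp only [hg]
      rw [← Finset.sum_sub_distrib]
      exact Finset.sum_congr rfl fun _ _ => by ring
    have r2 : ∑ q ∈ Q, ((K * (ind T y * ind S' (φ q y))) - (K * (ind T (φ (-q) y) * ind S' y))) =
        K * ind T y * ∑ q ∈ Q, ind S' (φ q y) - K * ind S' y * ∑ q ∈ Q, ind T (φ q y) := by
      rw [← hre, Finset.mul_sum, Finset.mul_sum, ← Finset.sum_sub_distrib]
      exact Finset.sum_congr rfl fun _ _ => by ring
    rw [r1, r2, hSind]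
    simp only [hf', hft]
    ring

/-- One carving step as a property of a set `U`. -/
lemma steps {d : ℕ} {X : Type*} [TopologicalSpace X] (φ : (Fin d → ℤ) → X ≃ₜ X)
    (hadd : ∀ v w x, φ (v + w) x = φ v (φ w x)) (hzero : ∀ x, φ 0 x = x)
    (N R : ℕ) (m K : ℤ) (hm : 1 ≤ m) (hK : 0 ≤ K)
    (hR : ∀ P : Finset (Fin d → ℤ), 0 ∈ P →
      ∃ D : Finset (Fin d → ℤ), D ⊆ P ∧ D ⊆ bx d R ∧ 0 ∈ D ∧
      (2 * m * K) * edg (bx d N) (· ∈ P) D ≤ D.card)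
    {ι : Type*} (t : Finset ι) (C : ι → Set X) (hC : ∀ i, IsClopen (C i))
    (hsep : ∀ i, ∀ c ∈ C i, ∀ v ∈ bx d (R + R), v ≠ 0 → φ v c ∉ C i)
    (f : X → ℤ) (hf : Continuous f) (hI : CarveInv φ N m K Set.univ f) :
    ∃ (S' : Set X) (f' g : X → ℤ), IsClopen S' ∧ (∀ i ∈ t, Disjoint S' (C i)) ∧ Continuous f' ∧
      CarveInv φ N m K S' f' ∧ Continuous g ∧ (∀ x, 0 ≤ g x) ∧
      Cob φ (fun x => f x - ind S' x * f' x - g x) := by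
  classical
  induction t using Finset.induction_on with
  | empty =>
    refine ⟨Set.univ, f, fun _ => 0, isClopen_univ, by simp, hf, hI, continuous_const,
      fun _ => le_rfl, ?_⟩
    convert Cob.zero using 2
    simp [ind]
  | insert a s ha ih =>
    obtain ⟨S1, f1, g1, hS1, hd1, hf1, hI1, hg1, hp1, hc1⟩ := ih
    obtain ⟨S2, f2, g2, hS2, hsub, hd2, hf2, hI2, hg2, hp2, hc2⟩ :=
      step φ hadd hzero N R m K hm hK hR (C a) (hC a) (hsep a) S1 hS1 f1 hf1 hI1
    refine ⟨S2, f2, fun x => g1 x + g2 x, hS2, ?_, hf2, hI2, hg1.add hg2,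
      fun x => add_nonneg (hp1 x) (hp2 x), ?_⟩
    · intro i hi
      rcases Finset.mem_insert.1 hi with rfl | hi
      · exact hd2
      · exact (hd1 i hi).mono_left hsub
    · convert hc1.add hc2 using 2
      ring

lemma sep_nhd {d : ℕ} {X : Type*} [TopologicalSpace X] [CompactSpace X] [T2Space X]
    [TotallyDisconnectedSpace X] (φ : (Fin d → ℤ) → X ≃ₜ X)
    (hφfree : ∀ (v) (x : X), φ v x = x → v = 0) (B : Finset (Fin d → ℤ)) (x : X) :
    ∃ C : Set X, IsClopen C ∧ x ∈ C ∧ ∀ c ∈ C, ∀ v ∈ B, v ≠ 0 → φ v c ∉ C := by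
  have h1 : ∀ v : Fin d → ℤ, ∃ C : Set X, IsClopen C ∧ x ∈ C ∧ (v ≠ 0 → ∀ c ∈ C, φ v c ∉ C) := by
    intro v
    by_cases hv : v = 0
    · exact ⟨Set.univ, isClopen_univ, trivial, fun h => absurd hv h⟩
    · have hne : x ≠ φ v x := fun h => hv (hφfree v x h.symm)
      obtain ⟨U, hU, hxU, hxU'⟩ := exists_isClopen_of_totally_separated hne
      refine ⟨U ∩ (φ v) ⁻¹' Uᶜ, hU.inter (hU.compl.preimage (φ v).continuous), ⟨hxU, hxU'⟩, ?_⟩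
      rintro _ c ⟨_, hc⟩ ⟨h, _⟩
      exact hc h
  choose C hC hx hCs using h1
  refine ⟨⋂ v ∈ B, C v, isClopen_biInter_finset fun v _ => hC v, by simp [hx], ?_⟩
  intro c hc v hv hv0 hcon
  simp only [Set.mem_iInter] at hc hcon
  exact hCs v hv0 c (hc v hv) (hcon v hv)

/-- The carving theorem. -/
lemma carving {d : ℕ} {X : Type*} [TopologicalSpace X] [CompactSpace X] [T2Space X]
    [TotallyDisconnectedSpace X] (φ : (Fin d → ℤ) → X ≃ₜ X)
    (hadd : ∀ v w x, φ (v + w) x = φ v (φ w x)) (hzero : ∀ x, φ 0 x = x)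
    (hφfree : ∀ (v) (x : X), φ v x = x → v = 0)
    (N : ℕ) (m K : ℤ) (hm : 1 ≤ m) (hK : 0 ≤ K)
    (f : X → ℤ) (hf : Continuous f) (hI : CarveInv φ N m K Set.univ f) :
    ∃ g : X → ℤ, Continuous g ∧ (∀ x, 0 ≤ g x) ∧ Cob φ (fun x => f x - g x) := by
  obtain ⟨R, hR⟩ := carve d N (2 * m * K).toNat
  rw [Int.toNat_of_nonneg (by positivity)] at hR
  choose C hC hx hsep using sep_nhd φ hφfree (bx d (R + R))
  obtain ⟨t, ht⟩ := isCompact_univ.elim_finite_subcover C (fun x => (hC x).isOpen)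
    (fun x _ => Set.mem_iUnion.2 ⟨x, hx x⟩)
  obtain ⟨S', f', g, -, hd, -, -, hg, hp, hc⟩ :=
    steps φ hadd hzero N R m K hm hK hR t C hC hsep f hf hI
  refine ⟨g, hg, hp, ?_⟩
  convert hc using 2 with x
  have : x ∉ S' := by
    intro hxS
    have := ht (Set.mem_univ x)
    simp only [Set.mem_iUnion] at this
    obtain ⟨i, hi, hxi⟩ := this
    exact Set.disjoint_left.1 (hd i hi) hxS hxi
  simp [ind, this]

lemma bdd {X : Type*} [TopologicalSpace X] [CompactSpace X] (g : C(X, ℤ)) :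
    ∃ M : ℤ, 0 ≤ M ∧ ∀ x, |g x| ≤ M := by
  have h := isCompact_range (g.continuous.abs)
  obtain ⟨M, hM⟩ := h.bddAbove
  refine ⟨max M 0, le_max_right _ _, fun x => (hM ⟨x, rfl⟩).trans (le_max_left _ _)⟩

open scoped Classical in
lemma edg_single {d N : ℕ} {v : Fin d → ℤ} (hv : v ∈ bx d N) (F : Finset (Fin d → ℤ)) :
    ((F.filter (fun u => u + v ∉ F)).card : ℤ) ≤ edg (bx d N) (fun _ => True) F := by
  unfold edg
  rw [Finset.sum_comm]
  have := Finset.single_le_sum (s := bx d N)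
    (f := fun q => ∑ u ∈ F, if u + q ∉ F ∧ True then (1 : ℤ) else 0)
    (fun q _ => Finset.sum_nonneg fun u _ => by split_ifs <;> norm_num) hv
  refine le_trans (le_of_eq ?_) (le_trans this (le_of_eq ?_))
  · simp only [and_true]
    rw [Finset.sum_boole]
  · simp only [and_true]

open scoped Classical in
/-- Shifting a sum over `F` costs at most the boundary. -/
lemma shift_le {d : ℕ} (F : Finset (Fin d → ℤ)) (v : Fin d → ℤ) (h : (Fin d → ℤ) → ℤ) :
    ∑ u ∈ F, h (u + v) = ∑ u ∈ F, h u - ∑ u ∈ F.filter (fun u => u + -v ∉ F), h u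
      + ∑ u ∈ F.filter (fun u => u + v ∉ F), h (u + v) := by
  have h1 := Finset.sum_filter_add_sum_filter_not F (fun u => u + v ∈ F) (fun u => h (u + v))
  have h2 := Finset.sum_filter_add_sum_filter_not F (fun u => u + -v ∈ F) h
  have h3 : ∑ u ∈ F.filter (fun u => u + v ∈ F), h (u + v) =
      ∑ u ∈ F.filter (fun u => u + -v ∈ F), h u := by
    apply Finset.sum_nbij' (fun u => u + v) (fun u => u + -v)
    · intro u hu; simp only [Finset.mem_filter] at *; simpa using hu.symm
    · intro u hu; simp only [Finset.mem_filter] at *; simpa using hu.symm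
    · simp
    · simp
    · simp
  linarith

lemma sum_bound {ι : Type*} (s : Finset ι) (h : ι → ℤ) (M : ℤ) (hM : ∀ i, |h i| ≤ M) :
    |∑ i ∈ s, h i| ≤ M * s.card := by
  refine (Finset.abs_sum_le_sum_abs _ _).trans ?_
  refine (Finset.sum_le_sum fun i _ => hM i).trans ?_
  simp [mul_comm]

lemma cob_bound {d : ℕ} {X : Type*} [TopologicalSpace X] [CompactSpace X]
    (φ : (Fin d → ℤ) → X ≃ₜ X) (hadd : ∀ v w x, φ (v + w) x = φ v (φ w x))
    (h : C(X, ℤ)) (hh : h ∈ cobSubgroup φ) :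
    ∃ (N : ℕ) (K : ℤ), 0 ≤ K ∧ ∀ x (F : Finset (Fin d → ℤ)),
      |∑ u ∈ F, h (φ u x)| ≤ K * edg (bx d N) (fun _ => True) F := by
  classical
  unfold cobSubgroup at hh
  induction hh using AddSubgroup.closure_induction with
  | mem h hmem =>
    obtain ⟨g, v, rfl⟩ := hmem
    obtain ⟨M, hM0, hM⟩ := bdd g
    obtain ⟨N, hN⟩ := exists_bx {v}
    have hv : v ∈ bx d N := hN (by simp)
    refine ⟨N, 2 * M, by positivity, fun x F => ?_⟩
    have h1 := shift_le F v (fun u => g (φ u x))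
    have h2 := sum_bound (F.filter (fun u => u + -v ∉ F)) (fun u => g (φ u x)) M (fun _ => hM _)
    have h3 := sum_bound (F.filter (fun u => u + v ∉ F)) (fun u => g (φ (u + v) x)) M
      (fun _ => hM _)
    have h4 := mul_le_mul_of_nonneg_left (edg_single (bx_neg hv) F) hM0
    have h5 := mul_le_mul_of_nonneg_left (edg_single hv F) hM0
    have h6 : ∑ u ∈ F, (g - g.comp ⟨⇑(φ v), (φ v).continuous⟩) (φ u x) =
        ∑ u ∈ F, g (φ u x) - ∑ u ∈ F, g (φ (u + v) x) := by
      rw [← Finset.sum_sub_distrib]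
      refine Finset.sum_congr rfl fun u _ => ?_
      rw [add_comm u v, hadd]
      rfl
    rw [h6]
    rw [abs_le] at *
    constructor <;> linarith [h2.1, h2.2, h3.1, h3.2]
  | zero => exact ⟨0, 0, le_rfl, fun x F => by simp⟩
  | add a b _ _ iha ihb =>
    obtain ⟨N, K, hK, h1⟩ := iha
    obtain ⟨N', K', hK', h2⟩ := ihb
    refine ⟨max N N', K + K', by positivity, fun x F => ?_⟩
    have e1 := mul_le_mul_of_nonneg_left
      (edg_mono (bx_mono (d := d) (le_max_left N N')) (fun _ => True) F) hK
    have e2 := mul_le_mul_of_nonneg_left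
      (edg_mono (bx_mono (d := d) (le_max_right N N')) (fun _ => True) F) hK'
    simp only [ContinuousMap.add_apply, Finset.sum_add_distrib]
    have := abs_add_le (∑ u ∈ F, a (φ u x)) (∑ u ∈ F, b (φ u x))
    have := h1 x F
    have := h2 x F
    linarith
  | neg a _ iha =>
    obtain ⟨N, K, hK, h1⟩ := iha
    refine ⟨N, K, hK, fun x F => ?_⟩
    simp only [ContinuousMap.neg_apply, Finset.sum_neg_distrib, abs_neg]
    exact h1 x F

lemma pos_bound {d : ℕ} {X : Type*} [TopologicalSpace X] [CompactSpace X]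
    (φ : (Fin d → ℤ) → X ≃ₜ X) (hadd : ∀ v w x, φ (v + w) x = φ v (φ w x))
    (hφmin : ∀ x : X, Dense {y | ∃ v, φ v x = y})
    (g : C(X, ℤ)) (hg : ∀ x, 0 ≤ g x) (hg0 : g ≠ 0) :
    ∃ (N : ℕ) (m K : ℤ), 1 ≤ m ∧ 0 ≤ K ∧ ∀ x (F : Finset (Fin d → ℤ)),
      (F.card : ℤ) ≤ m * ∑ u ∈ F, g (φ u x) + K * edg (bx d N) (fun _ => True) F := by
  classical
  have hopen : IsOpen {y | 0 < g y} := isOpen_lt continuous_const g.continuous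
  have hne : ({y | 0 < g y} : Set X).Nonempty := by
    by_contra h
    apply hg0
    ext x
    have h1 : ¬ 0 < g x := fun h' => h ⟨x, h'⟩
    have := hg x
    simp only [ContinuousMap.zero_apply]
    omega
  obtain ⟨t, ht⟩ := isCompact_univ.elim_finite_subcover
    (fun v : Fin d → ℤ => (φ v) ⁻¹' {y | 0 < g y}) (fun v => hopen.preimage (φ v).continuous)
    (fun x _ => by
      obtain ⟨y, hy, v, hv⟩ := (hφmin x).inter_open_nonempty _ hopen hne
      refine Set.mem_iUnion.2 ⟨v, ?_⟩
      rw [Set.mem_preimage, hv]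
      exact hy)
  obtain ⟨N, hN⟩ := exists_bx t
  obtain ⟨M, hM0, hM⟩ := bdd g
  refine ⟨N, (bx d N).card, M, ?_, hM0, fun x F => ?_⟩
  · have : 0 < (bx d N).card := Finset.card_pos.2 ⟨0, bx_zero⟩
    exact_mod_cast this
  have h1 : (F.card : ℤ) ≤ ∑ u ∈ F, ∑ v ∈ bx d N, g (φ (u + v) x) := by
    rw [Finset.cast_card]
    refine Finset.sum_le_sum fun u _ => ?_
    have := ht (Set.mem_univ (φ u x))
    simp only [Set.mem_iUnion, Set.mem_preimage] at this
    obtain ⟨v, hv, hpos⟩ := this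
    have hpos : 0 < g (φ v (φ u x)) := hpos
    have h2 := Finset.single_le_sum (s := bx d N) (f := fun v => g (φ (u + v) x))
      (fun v _ => hg _) (hN hv)
    rw [← hadd, add_comm v u] at hpos
    exact le_trans hpos h2
  have h2 : ∀ v ∈ bx d N, ∑ u ∈ F, g (φ (u + v) x) ≤ ∑ u ∈ F, g (φ u x) +
      M * (F.filter (fun u => u + v ∉ F)).card := by
    intro v _
    have e1 := shift_le F v (fun u => g (φ u x))
    have e2 : 0 ≤ ∑ u ∈ F.filter (fun u => u + -v ∉ F), g (φ u x) :=
      Finset.sum_nonneg fun _ _ => hg _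
    have e3 := (abs_le.1 (sum_bound (F.filter (fun u => u + v ∉ F)) (fun u => g (φ (u + v) x)) M
      (fun _ => hM _))).2
    linarith
  rw [Finset.sum_comm] at h1
  refine h1.trans ((Finset.sum_le_sum h2).trans (le_of_eq ?_))
  rw [Finset.sum_add_distrib, Finset.sum_const, nsmul_eq_mul, ← Finset.mul_sum]
  congr 2
  unfold edg
  rw [Finset.sum_comm]
  refine Finset.sum_congr rfl fun v _ => ?_
  simp only [and_true]
  rw [Finset.sum_boole]

/-- The dynamical cohomology group `(G(φ), G(φ)₊)` of a minimal (free)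
Cantor system is weakly unperforated: if `n ≥ 1` and `n[f] > 0`, then `[f] > 0`. -/
theorem stmt_13 {d : ℕ} {X : Type*} [TopologicalSpace X] [CompactSpace X] [T2Space X]
    [TotallyDisconnectedSpace X] (hXp : Perfect (Set.univ : Set X))
    (φ : (Fin d → ℤ) → X ≃ₜ X)
    (hφadd : ∀ v w x, φ (v + w) x = φ v (φ w x))
    (hφmin : ∀ x : X, Dense {y | ∃ v, φ v x = y})
    (hφfree : ∀ (v) (x : X), φ v x = x → v = 0)
    (n : ℤ) (hn : 1 ≤ n) (a : C(X, ℤ) ⧸ cobSubgroup φ)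
    (hpos : n • a ∈ posCone φ) (hne : n • a ≠ 0) :
    a ∈ posCone φ ∧ a ≠ 0 := by
  classical
  refine ⟨?_, fun h => hne (by rw [h, smul_zero])⟩
  have hzero : ∀ x, φ 0 x = x := fun x => by
    apply (φ 0).injective
    rw [← hφadd, add_zero]
  obtain ⟨f, rfl⟩ := QuotientAddGroup.mk_surjective a
  obtain ⟨g, hg, hgf⟩ := hpos
  have hg0 : g ≠ 0 := by
    rintro rfl
    exact hne (hgf.symm.trans (QuotientAddGroup.mk_zero _))
  have hcob : -g + n • f ∈ cobSubgroup φ := by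
    rw [← QuotientAddGroup.eq, hgf]
    rfl
  obtain ⟨N1, m1, K1, hm1, hK1, hb1⟩ := pos_bound φ hφadd hφmin g hg hg0
  obtain ⟨N2, K2, hK2, hb2⟩ := cob_bound φ hφadd _ hcob
  have hI : CarveInv φ (max N1 N2) (m1 * n) (m1 * K2 + K1) Set.univ f := by
    intro x F _
    have e1 := mul_le_mul_of_nonneg_left
      (edg_mono (bx_mono (d := d) (le_max_left N1 N2)) (fun _ => True) F) hK1
    have e2 := mul_le_mul_of_nonneg_left
      (edg_mono (bx_mono (d := d) (le_max_right N1 N2)) (fun _ => True) F) hK2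
    have h1 := hb1 x F
    have h2 := (abs_le.1 (hb2 x F)).1
    simp only [ContinuousMap.add_apply, ContinuousMap.neg_apply, ContinuousMap.smul_apply,
      Finset.sum_add_distrib, Finset.sum_neg_distrib, smul_eq_mul, ← Finset.mul_sum] at h2
    simp only [Set.mem_univ]
    have e0 := edg_nonneg (bx d (max N1 N2)) (fun _ => True) F
    set e := edg (bx d (max N1 N2)) (fun _ => True) F
    have h3 : ∑ u ∈ F, g (φ u x) ≤ n * ∑ u ∈ F, f (φ u x) + K2 * e := by linarith
    have h4 := mul_le_mul_of_nonneg_left h3 (by linarith : (0 : ℤ) ≤ m1)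
    have h5 : (m1 * K2 + K1) * e ≤ (m1 * n) * ((m1 * K2 + K1) * e) := by
      have hp : 0 ≤ (m1 * K2 + K1) * e := by positivity
      have : 1 ≤ m1 * n := by nlinarith
      nlinarith
    linarith
  obtain ⟨g', hg'c, hg'0, hcontg, hmem⟩ := carving φ hφadd hzero hφfree (max N1 N2) (m1 * n)
    (m1 * K2 + K1) (by nlinarith) (by positivity) f f.continuous hI
  refine ⟨⟨g', hg'c⟩, hg'0, ?_⟩
  rw [QuotientAddGroup.eq]
  convert hmem using 1
  ext x
  simp [sub_eq_neg_add]
end
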